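/- Let G be a symmetric N×N matrix with entries in {0,1}, for each pair (k,l) with G_{kl}=1 let A^{kl} be a real n×n matrix, and let T > 0. Let N̂ be the Nn×Nn block matrix whose (k,l) block is −A^{kl} when G_{kl}=1 and zero otherwise, let D be any real symmetric Nn×Nn matrix with λ_min(D) ≥ T, and set J = D + N̂. Then the smallest eigenvalue of the symmetrized matrix J̄ = (J + Jᵀ)/2 satisfies λ_min(J̄) ≥ T − (1/2) · δ_S · ‖G‖∞, where δ_S = max_{(k,l): G_{kl}=1} ‖A^{kl} + (A^{lk})ᵀ‖₂. In particular, if T > (1/2) δ_S ‖G‖∞, then J̄ is positive definite. -/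

import Mathlib

open scoped BigOperators
open Matrix

/-- Operator `2`-norm of a real matrix: the norm of the induced linear map between
Euclidean spaces. -/
noncomputable def opNorm2 {α β : Type*} [Fintype α] [Fintype β] [DecidableEq β]
    (M : Matrix α β ℝ) : ℝ :=
  ‖LinearMap.toContinuousLinearMap (Matrix.toEuclideanLin M)‖

/-- Operator `∞`-norm of a real matrix: maximum absolute row sum. -/
noncomputable def opNormInf {α β : Type*} [Fintype α] [Fintype β] (M : Matrix α β ℝ) : ℝ :=
  ⨆ i, ∑ j, |M i j|

/-- The smallest (real) eigenvalue of a real matrix: the infimum of its real spectrum. -/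
noncomputable def lambdaMin {α : Type*} [Fintype α] [DecidableEq α] (M : Matrix α α ℝ) : ℝ :=
  sInf (spectrum ℝ M)

/-- For a symmetric matrix, `c ≤ λ_min(M)` means exactly that `M - c I` is positive
semidefinite. -/
theorem le_lambdaMin_iff_posSemidef {α : Type*} [Fintype α] [DecidableEq α] [Nonempty α]
    {M : Matrix α α ℝ} (hM : M.IsSymm) (c : ℝ) :
    c ≤ lambdaMin M ↔ (M - algebraMap ℝ (Matrix α α ℝ) c).PosSemidef := by
  have hH : M.IsHermitian := isHermitian_iff_isSymm.2 hM
  have hspec := hH.spectrum_real_eq_range_eigenvalues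
  have hne : (spectrum ℝ M).Nonempty := hspec ▸ Set.range_nonempty _
  have hbdd : BddBelow (spectrum ℝ M) := hspec ▸ (Set.finite_range _).bddBelow
  have hsub : (M - algebraMap ℝ (Matrix α α ℝ) c).IsHermitian := by
    rw [isHermitian_iff_isSymm, Matrix.IsSymm, transpose_sub, hM.eq, algebraMap_eq_diagonal,
      diagonal_transpose]
  rw [posSemidef_iff_isHermitian_and_spectrum_nonneg, lambdaMin, le_csInf_iff hbdd hne,
    ← spectrum.sub_singleton_eq]
  simp [isHermitian_iff_isSymm.1 hsub, Set.subset_def]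

theorem opNorm2_nonneg {α β : Type*} [Fintype α] [Fintype β] [DecidableEq β]
    (M : Matrix α β ℝ) : 0 ≤ opNorm2 M :=
  norm_nonneg _

theorem abs_dotProduct_mulVec_le_opNorm2 {α β : Type*} [Fintype α] [Fintype β] [DecidableEq β]
    (M : Matrix α β ℝ) (x : α → ℝ) (y : β → ℝ) :
    |x ⬝ᵥ M *ᵥ y| ≤ opNorm2 M * ‖WithLp.toLp 2 x‖ * ‖WithLp.toLp 2 y‖ := by
  have h1 := abs_real_inner_le_norm (WithLp.toLp 2 (M *ᵥ y)) (WithLp.toLp 2 x)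
  have h2 : ‖WithLp.toLp 2 (M *ᵥ y)‖ ≤ opNorm2 M * ‖WithLp.toLp 2 y‖ := by
    simpa [opNorm2] using
      (LinearMap.toContinuousLinearMap (Matrix.toEuclideanLin M)).le_opNorm (WithLp.toLp 2 y)
  have h3 : inner ℝ (WithLp.toLp 2 (M *ᵥ y)) (WithLp.toLp 2 x) = x ⬝ᵥ M *ᵥ y := by
    rw [EuclideanSpace.inner_eq_star_dotProduct]
    simp
  rw [h3] at h1
  calc _ ≤ _ := h1
    _ ≤ opNorm2 M * ‖WithLp.toLp 2 y‖ * ‖WithLp.toLp 2 x‖ := by gcongr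
    _ = _ := by ring

theorem sum_abs_le_opNormInf {α β : Type*} [Fintype α] [Fintype β] (M : Matrix α β ℝ) (i : α) :
    ∑ j, |M i j| ≤ opNormInf M :=
  le_ciSup (f := fun i => ∑ j, |M i j|) (Set.finite_range _).bddAbove i

/-- A nonnegative symmetric kernel satisfies the Schur bound with constant its maximal row sum. -/
theorem sum_mul_mul_le_opNormInf {α : Type*} [Fintype α] {G : Matrix α α ℝ} (hG : G.IsSymm)
    (hG0 : ∀ k l, 0 ≤ G k l) (r : α → ℝ) :
    ∑ k, ∑ l, G k l * (r k * r l) ≤ opNormInf G * ∑ k, r k ^ 2 := by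
  have hrow : ∑ k, ∑ l, G k l * r k ^ 2 ≤ opNormInf G * ∑ k, r k ^ 2 := by
    rw [Finset.mul_sum]
    refine Finset.sum_le_sum fun k _ => ?_
    rw [← Finset.sum_mul]
    refine mul_le_mul_of_nonneg_right ?_ (sq_nonneg _)
    exact (Finset.sum_le_sum fun l _ => le_abs_self (G k l)).trans (sum_abs_le_opNormInf G k)
  have hcol : ∑ k, ∑ l, G k l * r l ^ 2 = ∑ k, ∑ l, G k l * r k ^ 2 := by
    rw [Finset.sum_comm]
    exact Finset.sum_congr rfl fun k _ => Finset.sum_congr rfl fun l _ => by rw [hG.apply]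
  have hpt : ∑ k, ∑ l, G k l * (r k * r l)
      ≤ ∑ k, ∑ l, (1 / 2 * (G k l * r k ^ 2) + 1 / 2 * (G k l * r l ^ 2)) :=
    Finset.sum_le_sum fun k _ => Finset.sum_le_sum fun l _ => by
      nlinarith [mul_nonneg (hG0 k l) (sq_nonneg (r k - r l))]
  simp only [Finset.sum_add_distrib, ← Finset.mul_sum] at hpt
  linarith

/-- The quadratic form of a block matrix as a sum over its blocks. -/
theorem dotProduct_mulVec_eq_sum_blocks {ι κ : Type*} [Fintype ι] [Fintype κ]
    (M : Matrix (ι × κ) (ι × κ) ℝ) (x : ι × κ → ℝ) :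
    x ⬝ᵥ M *ᵥ x = ∑ k, ∑ l, (fun a => x (k, a)) ⬝ᵥ
      (Matrix.of fun a b => M (k, a) (l, b)) *ᵥ fun b => x (l, b) := by
  simp only [dotProduct, mulVec, Fintype.sum_prod_type, Finset.mul_sum, Matrix.of_apply]
  exact Finset.sum_congr rfl fun k _ => Finset.sum_comm

/-- A block matrix whose blocks have operator norm at most `c * G k l`, with `G` nonnegative and
symmetric, has quadratic form bounded by `c * ‖G‖∞`. -/
theorem abs_dotProduct_mulVec_le_of_blocks {ι κ : Type*} [Fintype ι] [Fintype κ] [DecidableEq κ]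
    {G : Matrix ι ι ℝ} (hG : G.IsSymm) (hG0 : ∀ k l, 0 ≤ G k l) {c : ℝ} (hc : 0 ≤ c)
    (M : Matrix (ι × κ) (ι × κ) ℝ)
    (hM : ∀ k l, opNorm2 (Matrix.of fun a b => M (k, a) (l, b)) ≤ c * G k l) (x : ι × κ → ℝ) :
    |x ⬝ᵥ M *ᵥ x| ≤ c * opNormInf G * (x ⬝ᵥ x) := by
  set r : ι → ℝ := fun k => ‖WithLp.toLp 2 fun a => x (k, a)‖ with hr
  have hrx : ∑ k, r k ^ 2 = x ⬝ᵥ x := by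
    simp only [hr, EuclideanSpace.real_norm_sq_eq, dotProduct, Fintype.sum_prod_type, ← sq]
  rw [dotProduct_mulVec_eq_sum_blocks]
  calc _ ≤ ∑ k, ∑ l, c * G k l * r k * r l := by
        refine (Finset.abs_sum_le_sum_abs _ _).trans (Finset.sum_le_sum fun k _ => ?_)
        refine (Finset.abs_sum_le_sum_abs _ _).trans (Finset.sum_le_sum fun l _ => ?_)
        refine (abs_dotProduct_mulVec_le_opNorm2 _ _ _).trans ?_
        gcongr
        exact hM k l
    _ = c * ∑ k, ∑ l, G k l * (r k * r l) := by simp only [Finset.mul_sum, mul_assoc]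
    _ ≤ c * (opNormInf G * ∑ k, r k ^ 2) := by gcongr; exact sum_mul_mul_le_opNormInf hG hG0 r
    _ = _ := by rw [hrx, mul_assoc]

theorem opNorm2_smul {α β : Type*} [Fintype α] [Fintype β] [DecidableEq β] (t : ℝ)
    (M : Matrix α β ℝ) : opNorm2 (t • M) = |t| * opNorm2 M := by
  simp [opNorm2, norm_smul]

/-- If `G` is a symmetric `{0,1}` adjacency matrix, `N̂` the associated block matrix with
blocks `−A^{kl}`, `D` a real symmetric matrix with `λ_min(D) ≥ T`, and `J = D + N̂`, then
`λ_min((J + Jᵀ)/2) ≥ T − (1/2) δ_S ‖G‖∞`; in particular if `T > (1/2) δ_S ‖G‖∞` then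
`(J + Jᵀ)/2` is positive definite. -/
theorem stmt9 {N n : ℕ} (G : Matrix (Fin N) (Fin N) ℝ) (hGsym : G.IsSymm)
    (hG01 : ∀ k l, G k l = 0 ∨ G k l = 1)
    (A : Fin N → Fin N → Matrix (Fin n) (Fin n) ℝ)
    (T : ℝ) (hT : 0 < T)
    (Nhat : Matrix (Fin N × Fin n) (Fin N × Fin n) ℝ)
    (hNhat : ∀ k l a b, Nhat (k, a) (l, b) = if G k l = 1 then -(A k l a b) else 0)
    (D : Matrix (Fin N × Fin n) (Fin N × Fin n) ℝ) (hD : D.IsSymm)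
    (hDmin : T ≤ lambdaMin D)
    (J : Matrix (Fin N × Fin n) (Fin N × Fin n) ℝ) (hJ : J = D + Nhat)
    (δS : ℝ)
    (hδS : δS = ⨆ p : {q : Fin N × Fin N // G q.1 q.2 = 1},
      opNorm2 (A p.1.1 p.1.2 + (A p.1.2 p.1.1)ᵀ)) :
    T - (1 / 2) * δS * opNormInf G ≤ lambdaMin ((1 / 2 : ℝ) • (J + Jᵀ)) ∧
      ((1 / 2) * δS * opNormInf G < T → ((1 / 2 : ℝ) • (J + Jᵀ)).PosDef) := by
  have hG0 : ∀ k l, 0 ≤ G k l := fun k l => by rcases hG01 k l with h | h <;> simp [h]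
  have hδ0 : 0 ≤ δS := hδS ▸ Real.iSup_nonneg fun _ => opNorm2_nonneg _
  have hblock : ∀ k l, opNorm2 (Matrix.of fun a b =>
      ((1 / 2 : ℝ) • (Nhat + Nhatᵀ)) (k, a) (l, b)) ≤ 1 / 2 * δS * G k l := by
    intro k l
    have hlk : G l k = G k l := hGsym.apply k l
    rcases hG01 k l with h | h
    · have : (Matrix.of fun a b => ((1 / 2 : ℝ) • (Nhat + Nhatᵀ)) (k, a) (l, b)) = 0 := by
        ext a b
        simp [hNhat, hlk, h]
      rw [this, h]
      simp [opNorm2]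
    · have : (Matrix.of fun a b => ((1 / 2 : ℝ) • (Nhat + Nhatᵀ)) (k, a) (l, b)) =
          (-(1 / 2) : ℝ) • (A k l + (A l k)ᵀ) := by
        ext a b
        simp [hNhat, hlk, h]
        ring
      have hle : opNorm2 (A k l + (A l k)ᵀ) ≤ δS := by
        rw [hδS]
        exact le_ciSup (f := fun p : {q : Fin N × Fin N // G q.1 q.2 = 1} =>
          opNorm2 (A p.1.1 p.1.2 + (A p.1.2 p.1.1)ᵀ)) (Set.finite_range _).bddAbove ⟨(k, l), h⟩
      rw [this, opNorm2_smul, h, abs_neg, abs_of_pos (by norm_num : (0 : ℝ) < 1 / 2)]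
      linarith
  have hJsymm : ((1 / 2 : ℝ) • (J + Jᵀ)).IsSymm := by
    simp [Matrix.IsSymm, add_comm]
  have hN : ((1 / 2 : ℝ) • (Nhat + Nhatᵀ) +
      algebraMap ℝ (Matrix _ _ ℝ) (1 / 2 * δS * opNormInf G)).PosSemidef := by
    refine .of_dotProduct_mulVec_nonneg ?_ fun x => ?_
    · rw [isHermitian_iff_isSymm]
      simp [Matrix.IsSymm, add_comm, algebraMap_eq_diagonal]
    · have h := abs_dotProduct_mulVec_le_of_blocks hGsym hG0 (by positivity) _ hblock x
      rw [add_mulVec, dotProduct_add, Algebra.algebraMap_eq_smul_one,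
        smul_mulVec _ (1 : Matrix (Fin N × Fin n) (Fin N × Fin n) ℝ), one_mulVec,
        dotProduct_smul, star_trivial, smul_eq_mul]
      linarith [neg_le_of_abs_le h]
  have : Nonempty (Fin N × Fin n) := by
    by_contra hempty
    rw [not_nonempty_iff] at hempty
    have : lambdaMin D = 0 := by simp [lambdaMin, spectrum.of_subsingleton]
    linarith
  have hpsd : ((1 / 2 : ℝ) • (J + Jᵀ) -
      algebraMap ℝ (Matrix _ _ ℝ) (T - 1 / 2 * δS * opNormInf G)).PosSemidef := by
    convert ((le_lambdaMin_iff_posSemidef hD T).1 hDmin).add hN using 1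
    rw [hJ, transpose_add, hD.eq, map_sub]
    module
  refine ⟨(le_lambdaMin_iff_posSemidef hJsymm _).2 hpsd, fun hlt => ?_⟩
  convert (PosDef.one.smul (sub_pos.2 hlt)).add_posSemidef hpsd using 1
  rw [Algebra.algebraMap_eq_smul_one]
  abel
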